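/- Let n ≥ 2 and R ≥ 0, and for h > 0 let u_h be the unique maximal solution on [R, r₂(h)) of u''/(1+(u')²) + ((n−1)/ρ)·u' = −(1+nu)/u² with u_h(R⁺) = h, u_h'(R⁺) = 0, u_h > 0. Then: (i) if h₁ > h₂ then u_{h₁} > u_{h₂} wherever both are defined, and r₂(h₁) > r₂(h₂); (ii) r₂ : (0,∞) → (R,∞) is a continuous, strictly increasing bijection, and in particular r₂(h) → ∞ as h → ∞; (iii) the graphs {(ρ, u_h(ρ)) : R < ρ < r₂(h)}, h ∈ (0,∞), foliate the region {(ρ, y) : ρ > R, y > 0}; equivalently, for every ρ₀ > R and y₀ > 0 there is exactly one h > 0 with ρ₀ < r₂(h) and u_h(ρ₀) = y₀. -/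

import Mathlib

open Set Filter Topology

/-- The rotational soliton ODE in radial graph form:
`u''/(1+(u')²) + ((n−1)/ρ)·u' = −(1+nu)/u²` at `ρ`. -/
def RadODE (n : ℕ) (u : ℝ → ℝ) (ρ : ℝ) : Prop :=
  deriv (deriv u) ρ / (1 + (deriv u ρ) ^ 2) + (((n : ℝ) - 1) / ρ) * deriv u ρ =
    -(1 + (n : ℝ) * u ρ) / (u ρ) ^ 2

/-- `u` is a maximal positive solution of the radial rotational soliton ODE on
`[R,b)` with initial conditions `u(R⁺) = h`, `u'(R⁺) = 0` (understood as limits),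
which cannot be extended as a positive solution past `b`. -/
def IsMaxSol (n : ℕ) (R h b : ℝ) (u : ℝ → ℝ) : Prop :=
  R < b ∧
  (∀ ρ ∈ Set.Ioo R b, ContDiffAt ℝ 2 u ρ ∧ 0 < u ρ ∧ RadODE n u ρ) ∧
  Filter.Tendsto u (𝓝[>] R) (𝓝 h) ∧
  Filter.Tendsto (deriv u) (𝓝[>] R) (𝓝 0) ∧
  ¬ ∃ (b' : ℝ) (v : ℝ → ℝ), b < b' ∧ Set.EqOn v u (Set.Ioo R b) ∧
      ∀ ρ ∈ Set.Ioo R b', ContDiffAt ℝ 2 v ρ ∧ 0 < v ρ ∧ RadODE n v ρ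


/-- The second derivative prescribed by the radial soliton ODE at radius `x`, height `u`
and slope `p`. -/
noncomputable def radAcc (n : ℕ) (x u p : ℝ) : ℝ :=
  (1 + p ^ 2) * (-(((n : ℝ) - 1) / x * p) - (1 + (n : ℝ) * u) / u ^ 2)

/-- `u` is a positive solution of the radial soliton ODE on `(R, b)`, with derivative `p`. -/
structure IsRadSol (n : ℕ) (R b : ℝ) (u p : ℝ → ℝ) : Prop where
  hasDerivAt : ∀ x ∈ Ioo R b, HasDerivAt u (p x) x
  hasDerivAt_slope : ∀ x ∈ Ioo R b, HasDerivAt p (radAcc n x (u x) (p x)) x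
  pos : ∀ x ∈ Ioo R b, 0 < u x

/-- If `f` increases wherever it is at most `f x`, then it is at most `f x` to the left
of `x`. -/
lemma le_right_of_hasDerivAt_pos {f f' : ℝ → ℝ} {y x : ℝ} (hyx : y ≤ x)
    (hf : ∀ z ∈ Icc y x, HasDerivAt f (f' z) z)
    (hpos : ∀ z ∈ Icc y x, f z ≤ f x → 0 < f' z) : f y ≤ f x := by
  obtain ⟨z, hz, hmin⟩ := isCompact_Icc.exists_isMinOn (nonempty_Icc.2 hyx)
    (fun z hz => (hf z hz).continuousAt.continuousWithinAt)
  have hzx : f z ≤ f x := hmin (right_mem_Icc.2 hyx)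
  rcases hz.1.eq_or_lt with h | h
  · rwa [h]
  · exfalso
    have h1 : IsLocalMinOn f (Icc y z) z :=
      (hmin.on_subset (Icc_subset_Icc_right hz.2)).localize
    have h2 := h1.hasFDerivWithinAt_nonneg (hf z hz).hasFDerivAt.hasFDerivWithinAt
      (sub_mem_posTangentConeAt_of_segment_subset
        (by rw [segment_symm, segment_eq_Icc h.le]) : y - z ∈ _)
    have h3 := hpos z hz hzx
    simp only [ContinuousLinearMap.toSpanSingleton_apply, smul_eq_mul] at h2
    nlinarith

/-- The limit at the left endpoint bounds a strictly monotone function from below. -/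
lemma lt_of_tendsto_of_strictMonoOn {f : ℝ → ℝ} {a b l x : ℝ}
    (hf : StrictMonoOn f (Ioo a b)) (hl : Tendsto f (𝓝[>] a) (𝓝 l)) (hx : x ∈ Ioo a b) :
    l < f x := by
  obtain ⟨y, hy1, hy2⟩ := exists_between hx.1
  have hy : y ∈ Ioo a b := ⟨hy1, hy2.trans hx.2⟩
  refine lt_of_le_of_lt (le_of_tendsto hl ?_) (hf hy hx hy2)
  filter_upwards [Ioo_mem_nhdsGT hy1] with z hz
  exact (hf ⟨hz.1, hz.2.trans hy.2⟩ hy hz.2).le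

lemma strictMonoOn_Ioo_of_hasDerivAt_pos {f f' : ℝ → ℝ} {a b : ℝ}
    (hf : ∀ z ∈ Ioo a b, HasDerivAt f (f' z) z)
    (hpos : ∀ z ∈ Ioo a b, 0 < f' z) : StrictMonoOn f (Ioo a b) :=
  strictMonoOn_of_hasDerivWithinAt_pos (convex_Ioo _ _)
    (fun z hz => (hf z hz).continuousAt.continuousWithinAt)
    (fun z hz => (hf z (interior_subset hz)).hasDerivWithinAt)
    (fun z hz => hpos z (interior_subset hz))

/-- A function increasing wherever it is at most `c`, and whose limit at the left endpoint is
at least `c`, stays above `c`. -/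
lemma lt_of_hasDerivAt_pos_of_tendsto {f f' : ℝ → ℝ} {a x c l : ℝ} (hax : a < x)
    (hf : ∀ z ∈ Ioc a x, HasDerivAt f (f' z) z) (hl : Tendsto f (𝓝[>] a) (𝓝 l)) (hcl : c ≤ l)
    (hpos : ∀ z ∈ Ioc a x, f z ≤ c → 0 < f' z) : c < f x := by
  by_contra! hxc
  have hle : ∀ y ∈ Ioc a x, f y ≤ c := fun y hy =>
    (le_right_of_hasDerivAt_pos (f' := f') hy.2
      (fun z hz => hf z ⟨hy.1.trans_le hz.1, hz.2⟩)
      (fun z hz h => hpos z ⟨hy.1.trans_le hz.1, hz.2⟩ (h.trans hxc))).trans hxc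
  obtain ⟨y, hy1, hy2⟩ := exists_between hax
  have h1 : l < f y := lt_of_tendsto_of_strictMonoOn (b := x)
    (strictMonoOn_Ioo_of_hasDerivAt_pos (f' := f') (fun z hz => hf z ⟨hz.1, hz.2.le⟩)
      fun z hz => hpos z ⟨hz.1, hz.2.le⟩ (hle z ⟨hz.1, hz.2.le⟩)) hl ⟨hy1, hy2⟩
  linarith [hle y ⟨hy1, hy2.le⟩]

lemma antitoneOn_of_hasDerivAt_nonpos {f f' : ℝ → ℝ} {s : Set ℝ} (hs : Convex ℝ s)
    (hf : ∀ z ∈ s, HasDerivAt f (f' z) z) (hneg : ∀ z ∈ s, f' z ≤ 0) : AntitoneOn f s :=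
  antitoneOn_of_hasDerivWithinAt_nonpos hs
    (fun z hz => (hf z hz).continuousAt.continuousWithinAt)
    (fun z hz => (hf z (interior_subset hz)).hasDerivWithinAt)
    (fun z hz => hneg z (interior_subset hz))

/-- A function with nonpositive derivative is bounded above by its limit at the left endpoint. -/
lemma le_of_hasDerivAt_nonpos_of_tendsto {f f' : ℝ → ℝ} {a x l : ℝ} (hax : a < x)
    (hf : ∀ z ∈ Ioc a x, HasDerivAt f (f' z) z) (hl : Tendsto f (𝓝[>] a) (𝓝 l))
    (hneg : ∀ z ∈ Ioc a x, f' z ≤ 0) : f x ≤ l := by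
  refine ge_of_tendsto hl ?_
  filter_upwards [Ioo_mem_nhdsGT hax] with z hz
  exact antitoneOn_of_hasDerivAt_nonpos (convex_Ioc a x) hf hneg ⟨hz.1, hz.2.le⟩
    ⟨hax, le_rfl⟩ hz.2.le

/-- A continuous function starting above `c` and reaching `c` has a first point where it
takes the value `c`. -/
lemma exists_first_eq {f : ℝ → ℝ} {a b c l x : ℝ} (hf : ContinuousOn f (Ioo a b))
    (hl : Tendsto f (𝓝[>] a) (𝓝 l)) (hcl : c < l) (hx : x ∈ Ioo a b) (hxc : f x ≤ c) :
    ∃ z ∈ Ioc a x, f z = c ∧ ∀ y ∈ Ioo a z, c < f y := by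
  obtain ⟨d, hd, hdc⟩ := mem_nhdsGT_iff_exists_Ioo_subset.1 (hl.eventually_const_lt hcl)
  have hd : a < d := hd
  have hdx : d ≤ x := by
    by_contra! h
    exact absurd (hdc ⟨hx.1, h⟩) (not_lt.2 hxc)
  have hsub : Icc d x ⊆ Ioo a b := fun z hz => ⟨hd.trans_le hz.1, hz.2.trans_lt hx.2⟩
  have hcl' : IsClosed (Icc d x ∩ f ⁻¹' Iic c) :=
    (hf.mono hsub).preimage_isClosed_of_isClosed isClosed_Icc isClosed_Iic
  obtain ⟨z, ⟨hz1, hz2⟩, hz3⟩ :=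
    (isCompact_Icc.of_isClosed_subset hcl' inter_subset_left).exists_isLeast
      ⟨x, ⟨hdx, le_rfl⟩, hxc⟩
  have haz : a < z := hd.trans_le hz1.1
  have hlt : ∀ y ∈ Ioo a z, c < f y := by
    intro y hy
    rcases lt_or_ge y d with h | h
    · exact hdc ⟨hy.1, h⟩
    · by_contra! h2
      exact absurd (hz3 ⟨⟨h, hy.2.le.trans hz1.2⟩, h2⟩) (not_le.2 hy.2)
  refine ⟨z, ⟨haz, hz1.2⟩, le_antisymm hz2 ?_, hlt⟩
  have hcont : ContinuousAt f z := hf.continuousAt (Ioo_mem_nhds haz (hz1.2.trans_lt hx.2))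
  refine ge_of_tendsto (hcont.tendsto.mono_left nhdsWithin_le_nhds : Tendsto f (𝓝[<] z) _) ?_
  filter_upwards [Ioo_mem_nhdsLT haz] with y hy using (hlt y hy).le

lemma exists_tendsto_nhdsLT_of_abs_deriv_le {f f' : ℝ → ℝ} {c b K : ℝ} (hcb : c < b)
    (hf : ∀ x ∈ Ioo c b, HasDerivAt f (f' x) x) (hK : ∀ x ∈ Ioo c b, |f' x| ≤ K) :
    ∃ l, Tendsto f (𝓝[<] b) (𝓝 l) := by
  have hlip : LipschitzOnWith K.toNNReal f (Ioo c b) :=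
    (convex_Ioo c b).lipschitzOnWith_of_nnnorm_hasDerivWithin_le
      (fun x hx => (hf x hx).hasDerivWithinAt) (fun x hx => by
        rw [← NNReal.coe_le_coe, coe_nnnorm, Real.norm_eq_abs]
        exact (hK x hx).trans (Real.le_coe_toNNReal K))
  obtain ⟨g, hg, hfg⟩ := hlip.extend_real
  refine ⟨g b, ?_⟩
  have h1 : Tendsto g (𝓝[<] b) (𝓝 (g b)) :=
    hg.continuous.continuousAt.tendsto.mono_left nhdsWithin_le_nhds
  refine h1.congr' ?_
  filter_upwards [Ioo_mem_nhdsLT hcb] with x hx using (hfg hx).symm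

/-- Gluing two differentiable functions whose values and derivatives match at `b`. -/
lemma hasDerivAt_ite_lt {f f' φ φ' : ℝ → ℝ} {a b c ε : ℝ} (hab : a < b)
    (hε : 0 < ε) (hf : ∀ x ∈ Ioo a b, HasDerivAt f (f' x) x)
    (hφ : ∀ x ∈ Ioo (b - ε) c, HasDerivAt φ (φ' x) x)
    (hbc : b < c)
    (h0 : Tendsto f (𝓝[<] b) (𝓝 (φ b))) (h1 : Tendsto f' (𝓝[<] b) (𝓝 (φ' b))) :
    ∀ x ∈ Ioo a c, HasDerivAt (fun x => if x < b then f x else φ x)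
      (if x < b then f' x else φ' x) x := by
  intro x hx
  rcases lt_trichotomy x b with h | h | h
  · rw [if_pos h]
    refine (hf x ⟨hx.1, h⟩).congr_of_eventuallyEq ?_
    filter_upwards [Iio_mem_nhds h] with y hy using if_pos hy
  · subst h
    rw [if_neg (lt_irrefl _)]
    have hr : HasDerivWithinAt (fun y => if y < x then f y else φ y) (φ' x) (Ici x) x := by
      refine (hφ x ⟨by linarith, hbc⟩).hasDerivWithinAt.congr (fun y hy => ?_) ?_
      · exact if_neg (not_lt.2 hy)
      · exact if_neg (lt_irrefl _)
    have hl : HasDerivWithinAt (fun y => if y < x then f y else φ y) (φ' x) (Iic x) x := by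
      have hd : ∀ y ∈ Ioo a x,
          HasDerivAt (fun y => if y < x then f y else φ y) (f' y) y := by
        intro y hy
        refine (hf y hy).congr_of_eventuallyEq ?_
        filter_upwards [Iio_mem_nhds hy.2] with z hz using if_pos hz
      refine hasDerivWithinAt_Iic_of_tendsto_deriv (s := Ioo a x)
        (fun y hy => (hd y hy).differentiableAt.differentiableWithinAt) ?_
        (Ioo_mem_nhdsLT hab) ?_
      · have h2 : Tendsto (fun y => if y < x then f y else φ y) (𝓝[<] x) (𝓝 (φ x)) := by
          refine h0.congr' ?_
          filter_upwards [self_mem_nhdsWithin] with y hy using (if_pos hy).symm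
        unfold ContinuousWithinAt
        beta_reduce
        rw [if_neg (lt_irrefl x)]
        exact h2.mono_left (nhdsWithin_mono _ (fun y hy => hy.2))
      · refine h1.congr' ?_
        filter_upwards [Ioo_mem_nhdsLT hab] with y hy using (hd y hy).deriv.symm
    simpa using hl.union hr
  · rw [if_neg h.not_gt]
    refine (hφ x ⟨by linarith, hx.2⟩).congr_of_eventuallyEq ?_
    filter_upwards [Ioi_mem_nhds h] with y hy using if_neg (not_lt.2 (le_of_lt hy))

lemma continuousAt_radAcc (n : ℕ) {x u p : ℝ} (hx : x ≠ 0) (hu : u ≠ 0) :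
    ContinuousAt (fun q : ℝ × ℝ × ℝ => radAcc n q.1 q.2.1 q.2.2) (x, u, p) := by
  unfold radAcc
  have : (x, u, p).2.1 ^ 2 ≠ 0 := pow_ne_zero 2 hu
  fun_prop (disch := assumption)

/-- The radial equation has a local solution through any point with nonzero radius and
positive height. -/
lemma exists_local_radSol (n : ℕ) {b u₀ p₀ : ℝ} (hb : b ≠ 0) (hu : 0 < u₀) :
    ∃ ε > 0, ∃ φ ψ : ℝ → ℝ, φ b = u₀ ∧ ψ b = p₀ ∧ IsRadSol n (b - ε) (b + ε) φ ψ := by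
  have hX : ContDiffAt ℝ 1 (fun q : ℝ × ℝ × ℝ => ((1 : ℝ), q.2.2, radAcc n q.1 q.2.1 q.2.2))
      (b, u₀, p₀) := by
    unfold radAcc
    have h2 : (b, u₀, p₀).2.1 ^ 2 ≠ 0 := pow_ne_zero 2 hu.ne'
    have h1 : (b, u₀, p₀).1 ≠ 0 := hb
    fun_prop (disch := assumption)
  obtain ⟨α, hα, ε, hε, hd⟩ :=
    hX.exists_forall_mem_closedBall_exists_eq_forall_mem_Ioo_hasDerivAt₀ b
  have hbm : b ∈ Ioo (b - ε) (b + ε) := ⟨by linarith, by linarith⟩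
  have h1 : ∀ t ∈ Ioo (b - ε) (b + ε), HasDerivAt (fun t => (α t).1) 1 t := fun t ht =>
    (hd t ht).fst
  have h2 : ∀ t ∈ Ioo (b - ε) (b + ε), HasDerivAt (fun t => (α t).2.1) (α t).2.2 t := fun t ht =>
    (hd t ht).snd.fst
  have h3 : ∀ t ∈ Ioo (b - ε) (b + ε),
      HasDerivAt (fun t => (α t).2.2) (radAcc n (α t).1 (α t).2.1 (α t).2.2) t := fun t ht =>
    (hd t ht).snd.snd
  have ht : ∀ t ∈ Ioo (b - ε) (b + ε), (α t).1 = t := by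
    intro t ht
    have h4 : ∀ s ∈ Ioo (b - ε) (b + ε), HasDerivAt (fun t => (α t).1 - t) 0 s := fun s hs => by
      simpa using (h1 s hs).fun_sub (hasDerivAt_id' s)
    have := isOpen_Ioo.is_const_of_deriv_eq_zero isPreconnected_Ioo
      (fun s hs => (h4 s hs).differentiableAt.differentiableWithinAt)
      (fun s hs => (h4 s hs).deriv) ht hbm
    simp only [hα] at this
    linarith
  have hc : ContinuousAt (fun t => (α t).2.1) b := (h2 b hbm).continuousAt
  have hpos : ∀ᶠ t in 𝓝 b, 0 < (α t).2.1 := hc.eventually_const_lt (by simpa [hα] using hu)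
  obtain ⟨η, hη, hη'⟩ := Metric.eventually_nhds_iff.1 hpos
  have hsub : ∀ t ∈ Ioo (b - min ε η) (b + min ε η), t ∈ Ioo (b - ε) (b + ε) := fun t ht =>
    ⟨by linarith [ht.1, min_le_left ε η], by linarith [ht.2, min_le_left ε η]⟩
  refine ⟨min ε η, lt_min hε hη, fun t => (α t).2.1, fun t => (α t).2.2, by simp [hα],
    by simp [hα], fun t h => h2 t (hsub t h), fun t h => ?_, fun t h => ?_⟩
  · have := h3 t (hsub t h)
    rwa [ht t (hsub t h)] at this
  · apply hη'
    rw [Real.dist_eq, abs_lt]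
    constructor <;> linarith [h.1, h.2, min_le_right ε η]

lemma IsRadSol.contDiffAt_and_radODE {n : ℕ} {R b : ℝ} {u p : ℝ → ℝ} (hR : 0 ≤ R)
    (h : IsRadSol n R b u p) {x : ℝ} (hx : x ∈ Ioo R b) :
    ContDiffAt ℝ 2 u x ∧ 0 < u x ∧ RadODE n u x := by
  have hdu : ∀ y ∈ Ioo R b, deriv u y = p y := fun y hy => (h.hasDerivAt y hy).deriv
  have hev : ∀ y ∈ Ioo R b, deriv u =ᶠ[𝓝 y] p := fun y hy => by
    filter_upwards [isOpen_Ioo.mem_nhds hy] with z hz using hdu z hz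
  have hddu : ∀ y ∈ Ioo R b, HasDerivAt (deriv u) (radAcc n y (u y) (p y)) y := fun y hy =>
    (h.hasDerivAt_slope y hy).congr_of_eventuallyEq (hev y hy)
  refine ⟨?_, h.pos x hx, ?_⟩
  · have hC : ContDiffOn ℝ (1 + 1) u (Ioo R b) := by
      rw [contDiffOn_succ_iff_deriv_of_isOpen isOpen_Ioo]
      refine ⟨fun y hy => (h.hasDerivAt y hy).differentiableAt.differentiableWithinAt,
        by simp, ?_⟩
      rw [show (1 : WithTop ℕ∞) = 0 + 1 by simp, contDiffOn_succ_iff_deriv_of_isOpen isOpen_Ioo]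
      refine ⟨fun y hy => (hddu y hy).differentiableAt.differentiableWithinAt, by simp, ?_⟩
      rw [contDiffOn_zero]
      refine ContinuousOn.congr (f := fun y => radAcc n y (u y) (p y)) (fun y hy => ?_)
        (fun y hy => (hddu y hy).deriv)
      refine ContinuousAt.continuousWithinAt ?_
      exact (continuousAt_radAcc n (hR.trans_lt hy.1).ne' (h.pos y hy).ne').comp
        (f := fun y => (y, u y, p y))
        (continuousAt_id.prodMk ((h.hasDerivAt y hy).continuousAt.prodMk
          (h.hasDerivAt_slope y hy).continuousAt))
    have := hC.contDiffAt (isOpen_Ioo.mem_nhds hx)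
    rwa [one_add_one_eq_two] at this
  · have hxpos : x ≠ 0 := (hR.trans_lt hx.1).ne'
    have hup : u x ≠ 0 := (h.pos x hx).ne'
    have h1 : 1 + p x ^ 2 ≠ 0 := by positivity
    unfold RadODE
    rw [(hddu x hx).deriv, hdu x hx, radAcc, mul_div_cancel_left₀ _ h1]
    ring

/-- A solution whose height stays away from zero and whose slope stays bounded extends
past the right endpoint. -/
lemma IsRadSol.exists_extension {n : ℕ} {R b δ H M c : ℝ} {u p : ℝ → ℝ} (hR : 0 ≤ R)
    (h : IsRadSol n R b u p) (hc : c ∈ Ioo R b) (hδ : 0 < δ)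
    (hu : ∀ x ∈ Ioo c b, δ ≤ u x) (hH : ∀ x ∈ Ioo c b, u x ≤ H)
    (hp : ∀ x ∈ Ioo c b, |p x| ≤ M) :
    ∃ (b' : ℝ) (v : ℝ → ℝ), b < b' ∧ Set.EqOn v u (Set.Ioo R b) ∧
      ∀ ρ ∈ Set.Ioo R b', ContDiffAt ℝ 2 v ρ ∧ 0 < v ρ ∧ RadODE n v ρ := by
  have hc0 : 0 < c := hR.trans_lt hc.1
  have hb0 : 0 < b := hc0.trans hc.2
  have hsub : ∀ x ∈ Ioo c b, x ∈ Ioo R b := fun x hx => ⟨hc.1.trans hx.1, hx.2⟩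
  obtain ⟨u₀, hu₀⟩ := exists_tendsto_nhdsLT_of_abs_deriv_le hc.2
    (fun x hx => h.hasDerivAt x (hsub x hx)) hp
  have hacc : ∀ x ∈ Ioo c b, |radAcc n x (u x) (p x)| ≤
      (1 + M ^ 2) * (|(n : ℝ) - 1| / c * M + (1 + n * H) / δ ^ 2) := by
    intro x hx
    have hupos := h.pos x (hsub x hx)
    have hM : 0 ≤ M := (abs_nonneg _).trans (hp x hx)
    have h1 : p x ^ 2 ≤ M ^ 2 := by
      rw [← sq_abs (p x)]
      exact pow_le_pow_left₀ (abs_nonneg _) (hp x hx) 2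
    have hH0 : 0 ≤ 1 + n * H := by
      have := hupos.le.trans (hH x hx)
      positivity
    have hx0 : 0 < x := hc0.trans hx.1
    unfold radAcc
    rw [abs_mul, abs_of_nonneg (by positivity : 0 ≤ 1 + p x ^ 2)]
    gcongr
    refine (abs_sub _ _).trans ?_
    rw [abs_neg, abs_mul, abs_div, abs_of_pos hx0,
      abs_of_nonneg (by positivity : 0 ≤ (1 + n * u x) / u x ^ 2)]
    have h2 := hp x hx
    have h3 := hu x hx
    have h4 := hH x hx
    have h5 := hx.1.le
    gcongr
  obtain ⟨p₀, hp₀⟩ := exists_tendsto_nhdsLT_of_abs_deriv_le hc.2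
    (fun x hx => h.hasDerivAt_slope x (hsub x hx)) hacc
  have hu₀δ : δ ≤ u₀ := by
    refine ge_of_tendsto hu₀ ?_
    filter_upwards [Ioo_mem_nhdsLT hc.2] with x hx using hu x hx
  obtain ⟨ε, hε, φ, ψ, hφb, hψb, hφ⟩ :=
    exists_local_radSol n (p₀ := p₀) hb0.ne' (hδ.trans_le hu₀δ)
  have hacc₀ : Tendsto (fun x => radAcc n x (u x) (p x)) (𝓝[<] b)
      (𝓝 (radAcc n b (φ b) (ψ b))) := by
    rw [hφb, hψb]
    have h1 := (continuousAt_radAcc n (p := p₀) hb0.ne' (hδ.trans_le hu₀δ).ne').tendsto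
    refine h1.comp (f := fun x => (x, u x, p x)) ?_
    rw [nhds_prod_eq, nhds_prod_eq]
    exact (tendsto_id.mono_left nhdsWithin_le_nhds).prodMk (hu₀.prodMk hp₀)
  have hbε : b < b + ε := by linarith
  have hRb : R < b := hc.1.trans hc.2
  have hext : IsRadSol n R (b + ε) (fun x => if x < b then u x else φ x)
      (fun x => if x < b then p x else ψ x) := by
    refine ⟨hasDerivAt_ite_lt hRb hε h.hasDerivAt hφ.hasDerivAt hbε (by rwa [hφb])
      (by rwa [hψb]), fun x hx => ?_, fun x hx => ?_⟩
    · have := hasDerivAt_ite_lt hRb hε h.hasDerivAt_slope hφ.hasDerivAt_slope hbε (by rwa [hψb])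
        hacc₀ x hx
      convert this using 1
      split_ifs <;> rfl
    · split_ifs with hxb
      · exact h.pos x ⟨hx.1, hxb⟩
      · exact hφ.pos x ⟨by linarith, hx.2⟩
  exact ⟨b + ε, fun x => if x < b then u x else φ x, hbε, fun x hx => if_pos hx.2,
    fun x hx => hext.contDiffAt_and_radODE hR hx⟩

/-- A positive solution on `(R, b)` of the radial equation starting at height `h` with
horizontal slope. -/
structure IsInitSol (n : ℕ) (R h b : ℝ) (u p : ℝ → ℝ) : Prop extends IsRadSol n R b u p where
  tendsto : Tendsto u (𝓝[>] R) (𝓝 h)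
  tendsto_slope : Tendsto p (𝓝[>] R) (𝓝 0)

lemma IsMaxSol.isInitSol {n : ℕ} {R h b : ℝ} {u : ℝ → ℝ} (hu : IsMaxSol n R h b u) :
    IsInitSol n R h b u (deriv u) := by
  obtain ⟨-, hsol, hlim, hlim', -⟩ := hu
  have hC : ContDiffOn ℝ (1 + 1) u (Ioo R b) := fun x hx => by
    rw [one_add_one_eq_two]
    exact (hsol x hx).1.contDiffWithinAt
  rw [contDiffOn_succ_iff_deriv_of_isOpen isOpen_Ioo] at hC
  refine ⟨⟨fun x hx => ?_, fun x hx => ?_, fun x hx => (hsol x hx).2.1⟩, hlim, hlim'⟩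
  · exact (hC.1.differentiableAt (isOpen_Ioo.mem_nhds hx)).hasDerivAt
  · have h1 : HasDerivAt (deriv u) (deriv (deriv u) x) x :=
      ((hC.2.2.differentiableOn one_ne_zero).differentiableAt
        (isOpen_Ioo.mem_nhds hx)).hasDerivAt
    have h2 := (hsol x hx).2.2
    unfold RadODE at h2
    have h3 : 1 + deriv u x ^ 2 ≠ 0 := by positivity
    convert h1 using 1
    rw [radAcc, ← div_mul_cancel₀ (deriv (deriv u) x) h3, eq_sub_of_add_eq h2]
    ring

lemma radForce_anti (n : ℕ) {δ u : ℝ} (hδ : 0 < δ) (hu : δ ≤ u) :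
    (1 + (n : ℝ) * u) / u ^ 2 ≤ (1 + (n : ℝ) * δ) / δ ^ 2 := by
  have hu0 : 0 < u := hδ.trans_le hu
  have h : ∀ v : ℝ, 0 < v → (1 + (n : ℝ) * v) / v ^ 2 = 1 / v ^ 2 + n / v := by
    intro v hv
    field_simp
  rw [h u hu0, h δ hδ]
  gcongr

lemma radForce_strictAnti (n : ℕ) {δ u : ℝ} (hδ : 0 < δ) (hu : δ < u) :
    (1 + (n : ℝ) * u) / u ^ 2 < (1 + (n : ℝ) * δ) / δ ^ 2 := by
  have hu0 : 0 < u := hδ.trans hu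
  have h : ∀ v : ℝ, 0 < v → (1 + (n : ℝ) * v) / v ^ 2 = 1 / v ^ 2 + n / v := by
    intro v hv
    field_simp
  rw [h u hu0, h δ hδ]
  have h1 : 1 / u ^ 2 < 1 / δ ^ 2 := by gcongr
  have h2 : (n : ℝ) / u ≤ n / δ := by gcongr
  linarith

/-- The soliton forcing term is Lipschitz away from zero height. -/
lemma radForce_sub_le (n : ℕ) {δ u v : ℝ} (hδ : 0 < δ) (hu : δ ≤ u) (huv : u ≤ v) :
    (1 + (n : ℝ) * u) / u ^ 2 - (1 + (n : ℝ) * v) / v ^ 2 ≤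
      (2 / δ ^ 3 + n / δ ^ 2) * (v - u) := by
  have hu0 : 0 < u := hδ.trans_le hu
  have hv0 : 0 < v := hu0.trans_le huv
  have hv : δ ≤ v := hu.trans huv
  have h : (1 + (n : ℝ) * u) / u ^ 2 - (1 + (n : ℝ) * v) / v ^ 2 =
      (1 / (u * v ^ 2) + 1 / (u ^ 2 * v) + n / (u * v)) * (v - u) := by
    field_simp
    ring
  rw [h]
  have h0 : 0 ≤ v - u := by linarith
  refine mul_le_mul_of_nonneg_right ?_ h0
  have h1 : 1 / (u * v ^ 2) ≤ 1 / (δ * δ ^ 2) := by gcongr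
  have h2 : 1 / (u ^ 2 * v) ≤ 1 / (δ ^ 2 * δ) := by gcongr
  have h3 : (n : ℝ) / (u * v) ≤ n / (δ * δ) := by gcongr
  have h4 : 2 / δ ^ 3 + n / δ ^ 2 = 1 / (δ * δ ^ 2) + 1 / (δ ^ 2 * δ) + n / (δ * δ) := by
    field_simp
    ring
  linarith

lemma IsRadSol.hasDerivAt_arctan {n : ℕ} {R b x : ℝ} {u p : ℝ → ℝ} (h : IsRadSol n R b u p)
    (hx : x ∈ Ioo R b) :
    HasDerivAt (fun y => Real.arctan (p y))
      (-(((n : ℝ) - 1) / x * p x) - (1 + (n : ℝ) * u x) / u x ^ 2) x := by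
  have h1 := (h.hasDerivAt_slope x hx).arctan
  have h2 : 1 + p x ^ 2 ≠ 0 := by positivity
  convert h1 using 1
  rw [radAcc]
  field_simp

lemma IsInitSol.slope_neg {n : ℕ} {R h b x : ℝ} {u p : ℝ → ℝ} (hn : 2 ≤ n) (hR : 0 ≤ R)
    (hu : IsInitSol n R h b u p) (hx : x ∈ Ioo R b) : p x < 0 := by
  have hn' : (2 : ℝ) ≤ n := by exact_mod_cast hn
  have hsub : ∀ z ∈ Ioc R x, z ∈ Ioo R b := fun z hz => ⟨hz.1, hz.2.trans_lt hx.2⟩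
  have := lt_of_hasDerivAt_pos_of_tendsto (f := fun y => -p y) (c := 0) (l := 0) hx.1
    (fun z hz => (hu.hasDerivAt_slope z (hsub z hz)).neg)
    (by simpa using hu.tendsto_slope.neg) le_rfl (fun z hz hpz => by
      have hz0 : 0 < z := hR.trans_lt hz.1
      have hup := hu.pos z (hsub z hz)
      have h1 : 0 ≤ p z := by simpa using hpz
      have h2 : 0 ≤ ((n : ℝ) - 1) / z * p z :=
        mul_nonneg (div_nonneg (by linarith) hz0.le) h1
      have h3 : 0 < (1 + (n : ℝ) * u z) / u z ^ 2 := by positivity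
      rw [radAcc, ← mul_neg]
      exact mul_pos (by positivity) (by linarith))
  linarith

lemma IsInitSol.strictAntiOn {n : ℕ} {R h b : ℝ} {u p : ℝ → ℝ} (hn : 2 ≤ n) (hR : 0 ≤ R)
    (hu : IsInitSol n R h b u p) : StrictAntiOn u (Ioo R b) :=
  strictAntiOn_of_hasDerivWithinAt_neg (convex_Ioo _ _)
    (fun z hz => (hu.hasDerivAt z hz).continuousAt.continuousWithinAt)
    (fun z hz => (hu.hasDerivAt z (interior_subset hz)).hasDerivWithinAt)
    (fun _ hz => hu.slope_neg hn hR (interior_subset hz))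

lemma IsInitSol.lt_height {n : ℕ} {R h b x : ℝ} {u p : ℝ → ℝ} (hn : 2 ≤ n) (hR : 0 ≤ R)
    (hu : IsInitSol n R h b u p) (hx : x ∈ Ioo R b) : u x < h := by
  have := lt_of_tendsto_of_strictMonoOn (f := fun y => -u y) (a := R) (b := b) (l := -h)
    (fun y hy z hz hyz => neg_lt_neg (hu.strictAntiOn hn hR hy hz hyz)) hu.tendsto.neg hx
  linarith

/-- The slope is bounded as long as the height is at least `δ` and the radius at most `B`. -/
lemma IsInitSol.neg_lt_slope {n : ℕ} {R h b x δ B : ℝ} {u p : ℝ → ℝ} (hn : 2 ≤ n) (hR : 0 ≤ R)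
    (hu : IsInitSol n R h b u p) (hx : x ∈ Ioo R b) (hδ : 0 < δ) (hδu : δ ≤ u x) (hxB : x ≤ B) :
    -(B * ((1 + n * δ) / δ ^ 2 + 1)) < p x := by
  have hn' : (2 : ℝ) ≤ n := by exact_mod_cast hn
  have hB : 0 < B := (hR.trans_lt hx.1).trans_le hxB
  have hsub : ∀ z ∈ Ioc R x, z ∈ Ioo R b := fun z hz => ⟨hz.1, hz.2.trans_lt hx.2⟩
  refine lt_of_hasDerivAt_pos_of_tendsto hx.1
    (fun z hz => hu.hasDerivAt_slope z (hsub z hz)) hu.tendsto_slope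
    (neg_nonpos.2 (by positivity)) (fun z hz hpz => ?_)
  have hz0 : 0 < z := hR.trans_lt hz.1
  have h1 : δ ≤ u z := hδu.trans ((hu.strictAntiOn hn hR).antitoneOn (hsub z hz) hx hz.2)
  have h2 := radForce_anti n hδ h1
  have h3 : (1 + n * δ) / δ ^ 2 + 1 ≤ ((n : ℝ) - 1) / z * (-p z) := by
    calc (1 + n * δ) / δ ^ 2 + 1 = 1 / B * (B * ((1 + n * δ) / δ ^ 2 + 1)) := by field_simp
      _ ≤ ((n : ℝ) - 1) / z * (-p z) := by
        have h4 : B * ((1 + n * δ) / δ ^ 2 + 1) ≤ -p z := by linarith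
        have h5 : z ≤ B := hz.2.trans hxB
        have h6 : (1 : ℝ) ≤ n - 1 := by linarith
        have h7 : (0 : ℝ) ≤ n - 1 := by linarith
        gcongr
  rw [radAcc]
  exact mul_pos (by positivity) (by linarith)

/-- A maximal solution reaches arbitrarily small heights. -/
lemma IsMaxSol.exists_lt {n : ℕ} {R h b δ : ℝ} {u : ℝ → ℝ} (hn : 2 ≤ n) (hR : 0 ≤ R)
    (hu : IsMaxSol n R h b u) (hδ : 0 < δ) : ∃ x ∈ Ioo R b, u x < δ := by
  by_contra! hge
  have hi := hu.isInitSol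
  obtain ⟨hRb, -, -, -, hmax⟩ := hu
  obtain ⟨c, hc⟩ := nonempty_Ioo.2 hRb
  have hsub : ∀ x ∈ Ioo c b, x ∈ Ioo R b := fun x hx => ⟨hc.1.trans hx.1, hx.2⟩
  refine hmax (hi.toIsRadSol.exists_extension hR hc hδ (fun x hx => hge x (hsub x hx))
    (fun x hx => (hi.lt_height hn hR (hsub x hx)).le)
    (M := b * ((1 + n * δ) / δ ^ 2 + 1)) (fun x hx => ?_))
  have h1 := hi.slope_neg hn hR (hsub x hx)
  have h2 := hi.neg_lt_slope hn hR (hsub x hx) hδ (hge x (hsub x hx)) hx.2.le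
  rw [abs_of_neg h1]
  linarith

section Comparison

variable {n : ℕ} {R h₁ h₂ b₁ b₂ : ℝ} {u₁ p₁ u₂ p₂ : ℝ → ℝ}

lemma IsInitSol.slope_lt_of_lt (hn : 2 ≤ n) (hR : 0 ≤ R) (H₁ : IsInitSol n R h₁ b₁ u₁ p₁)
    (H₂ : IsInitSol n R h₂ b₂ u₂ p₂) {x : ℝ} (hRx : R < x) (hx₁ : x < b₁) (hx₂ : x < b₂)
    (hlt : ∀ z ∈ Ioc R x, u₂ z < u₁ z) : p₂ x < p₁ x := by
  have hn' : (2 : ℝ) ≤ n := by exact_mod_cast hn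
  have hs₁ : ∀ z ∈ Ioc R x, z ∈ Ioo R b₁ := fun z hz => ⟨hz.1, hz.2.trans_lt hx₁⟩
  have hs₂ : ∀ z ∈ Ioc R x, z ∈ Ioo R b₂ := fun z hz => ⟨hz.1, hz.2.trans_lt hx₂⟩
  have hlim : Tendsto (fun y => Real.arctan (p₁ y) - Real.arctan (p₂ y)) (𝓝[>] R) (𝓝 0) := by
    simpa using ((Real.continuous_arctan.tendsto 0).comp H₁.tendsto_slope).sub
      ((Real.continuous_arctan.tendsto 0).comp H₂.tendsto_slope)
  have := lt_of_hasDerivAt_pos_of_tendsto hRx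
    (fun z hz => (H₁.hasDerivAt_arctan (hs₁ z hz)).sub (H₂.hasDerivAt_arctan (hs₂ z hz)))
    hlim le_rfl (fun z hz hle => by
      have h1 : p₁ z ≤ p₂ z := Real.arctan_strictMono.le_iff_le.1 (sub_nonpos.1 hle)
      have h2 := radForce_strictAnti n (H₂.pos z (hs₂ z hz)) (hlt z hz)
      have h3 : ((n : ℝ) - 1) / z * p₁ z ≤ ((n : ℝ) - 1) / z * p₂ z :=
        mul_le_mul_of_nonneg_left h1
          (div_nonneg (by linarith) (hR.trans hz.1.le))
      linarith)
  exact Real.arctan_strictMono.lt_iff_lt.1 (sub_pos.1 this)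

lemma IsInitSol.lt_of_lt (hn : 2 ≤ n) (hR : 0 ≤ R) (H₁ : IsInitSol n R h₁ b₁ u₁ p₁)
    (H₂ : IsInitSol n R h₂ b₂ u₂ p₂) (hh : h₂ < h₁) :
    ∀ x ∈ Ioo R (min b₁ b₂), u₂ x < u₁ x := by
  have hs₁ : ∀ z ∈ Ioo R (min b₁ b₂), z ∈ Ioo R b₁ :=
    fun z hz => ⟨hz.1, hz.2.trans_le (min_le_left _ _)⟩
  have hs₂ : ∀ z ∈ Ioo R (min b₁ b₂), z ∈ Ioo R b₂ :=
    fun z hz => ⟨hz.1, hz.2.trans_le (min_le_right _ _)⟩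
  have hd : ∀ z ∈ Ioo R (min b₁ b₂), HasDerivAt (fun y => u₁ y - u₂ y) (p₁ z - p₂ z) z :=
    fun z hz => (H₁.hasDerivAt z (hs₁ z hz)).sub (H₂.hasDerivAt z (hs₂ z hz))
  have hlim : Tendsto (fun y => u₁ y - u₂ y) (𝓝[>] R) (𝓝 (h₁ - h₂)) := H₁.tendsto.sub H₂.tendsto
  intro x hx
  by_contra! hle
  obtain ⟨z, hz, hz0, hpos⟩ := exists_first_eq (c := 0)
    (fun y hy => (hd y hy).continuousAt.continuousWithinAt) hlim (sub_pos.2 hh) hx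
    (sub_nonpos.2 hle)
  have hzm : z ∈ Ioo R (min b₁ b₂) := ⟨hz.1, hz.2.trans_lt hx.2⟩
  have hsub : ∀ y ∈ Ioo R z, y ∈ Ioo R (min b₁ b₂) := fun y hy => ⟨hy.1, hy.2.trans hzm.2⟩
  have hmono : StrictMonoOn (fun y => u₁ y - u₂ y) (Ioo R z) :=
    strictMonoOn_Ioo_of_hasDerivAt_pos (fun y hy => hd y (hsub y hy)) (fun y hy =>
      sub_pos.2 (H₁.slope_lt_of_lt hn hR H₂ hy.1 (hs₁ y (hsub y hy)).2 (hs₂ y (hsub y hy)).2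
        (fun t ht => sub_pos.1 (hpos t ⟨ht.1, ht.2.trans_lt hy.2⟩))))
  have hge : h₁ - h₂ ≤ u₁ z - u₂ z := by
    refine ge_of_tendsto ((hd z hzm).continuousAt.tendsto.mono_left nhdsWithin_le_nhds :
      Tendsto _ (𝓝[<] z) _) ?_
    filter_upwards [Ioo_mem_nhdsLT hz.1] with y hy
    exact (lt_of_tendsto_of_strictMonoOn hmono hlim hy).le
  linarith

/-- The vertical distance between two solutions exceeds its initial value. -/
lemma IsInitSol.sub_lt_sub (hn : 2 ≤ n) (hR : 0 ≤ R) (H₁ : IsInitSol n R h₁ b₁ u₁ p₁)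
    (H₂ : IsInitSol n R h₂ b₂ u₂ p₂) (hh : h₂ < h₁) {x : ℝ} (hRx : R < x) (hx₁ : x < b₁)
    (hx₂ : x < b₂) : h₁ - h₂ < u₁ x - u₂ x := by
  have hlt := H₁.lt_of_lt hn hR H₂ hh
  refine lt_of_tendsto_of_strictMonoOn (f := fun y => u₁ y - u₂ y) (b := min b₁ b₂)
    (strictMonoOn_Ioo_of_hasDerivAt_pos (f' := fun y => p₁ y - p₂ y) (fun z hz =>
      (H₁.hasDerivAt z ⟨hz.1, hz.2.trans_le (min_le_left _ _)⟩).sub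
        (H₂.hasDerivAt z ⟨hz.1, hz.2.trans_le (min_le_right _ _)⟩))
      (fun z hz => sub_pos.2 ?_)) (H₁.tendsto.sub H₂.tendsto) ⟨hRx, lt_min hx₁ hx₂⟩
  exact H₁.slope_lt_of_lt hn hR H₂ hz.1 (hz.2.trans_le (min_le_left _ _))
    (hz.2.trans_le (min_le_right _ _)) (fun t ht => hlt t ⟨ht.1, ht.2.trans_lt hz.2⟩)

lemma IsMaxSol.radius_lt (hn : 2 ≤ n) (hR : 0 ≤ R) (H₁ : IsMaxSol n R h₁ b₁ u₁)
    (H₂ : IsMaxSol n R h₂ b₂ u₂) (hh : h₂ < h₁) : b₂ < b₁ := by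
  by_contra! hb
  obtain ⟨x, hx, hxlt⟩ := H₁.exists_lt hn hR (sub_pos.2 hh)
  have h1 := H₁.isInitSol.sub_lt_sub hn hR H₂.isInitSol hh hx.1 hx.2 (hx.2.trans_le hb)
  have h2 := H₂.isInitSol.pos x ⟨hx.1, hx.2.trans_le hb⟩
  linarith

lemma sub_le_mul_arctan_sub {M a c : ℝ} (ha : -M ≤ a) (hac : a ≤ c) (hc : c ≤ M) :
    c - a ≤ (1 + M ^ 2) * (Real.arctan c - Real.arctan a) := by
  have h := antitoneOn_of_hasDerivAt_nonpos (f := fun y => y - (1 + M ^ 2) * Real.arctan y)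
    (convex_Icc (-M) M)
    (fun y _ => (hasDerivAt_id' y).sub ((Real.hasDerivAt_arctan y).const_mul (1 + M ^ 2)))
    (fun y hy => by
      have h1 : 1 + y ^ 2 ≤ 1 + M ^ 2 := by nlinarith [hy.1, hy.2]
      have h2 : 0 < 1 + y ^ 2 := by positivity
      rw [sub_nonpos, mul_one_div, le_div_iff₀ h2]
      linarith) ⟨ha, hac.trans hc⟩ ⟨ha.trans hac, hc⟩ hac
  simp only at h
  linarith

/-- Continuous dependence on the initial height, with a constant depending only on a lower
bound for the height and an upper bound for the radius. -/
lemma IsInitSol.sub_le_exp_mul {δ B : ℝ} (hn : 2 ≤ n) (hR : 0 ≤ R) (hδ : 0 < δ) :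
    ∃ K > 0, ∀ {h₁ h₂ b₁ b₂ : ℝ} {u₁ p₁ u₂ p₂ : ℝ → ℝ}, IsInitSol n R h₁ b₁ u₁ p₁ →
      IsInitSol n R h₂ b₂ u₂ p₂ → h₂ < h₁ → ∀ {x : ℝ}, R < x → x < b₁ → x < b₂ → x ≤ B →
      δ ≤ u₂ x → u₁ x - u₂ x ≤ K * (h₁ - h₂) := by
  set L : ℝ := 2 / δ ^ 3 + n / δ ^ 2 with hL
  set M : ℝ := B * ((1 + n * δ) / δ ^ 2 + 1) with hM
  set D : ℝ := (1 + M ^ 2) * (L * B) with hD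
  refine ⟨Real.exp (D * B), Real.exp_pos _, ?_⟩
  intro h₁ h₂ b₁ b₂ u₁ p₁ u₂ p₂ H₁ H₂ hh x hRx hx₁ hx₂ hxB hδu
  have hn' : (2 : ℝ) ≤ n := by exact_mod_cast hn
  have hB : 0 < B := (hR.trans_lt hRx).trans_le hxB
  have hL0 : 0 ≤ L := by positivity
  have hD0 : 0 ≤ D := by positivity
  have hs₁ : ∀ z ∈ Ioc R x, z ∈ Ioo R b₁ := fun z hz => ⟨hz.1, hz.2.trans_lt hx₁⟩
  have hs₂ : ∀ z ∈ Ioc R x, z ∈ Ioo R b₂ := fun z hz => ⟨hz.1, hz.2.trans_lt hx₂⟩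
  have hlt : ∀ z ∈ Ioc R x, u₂ z < u₁ z := fun z hz =>
    H₁.lt_of_lt hn hR H₂ hh z ⟨hz.1, lt_min (hs₁ z hz).2 (hs₂ z hz).2⟩
  have hδ₂ : ∀ z ∈ Ioc R x, δ ≤ u₂ z := fun z hz =>
    hδu.trans ((H₂.strictAntiOn hn hR).antitoneOn (hs₂ z hz) ⟨hRx, hx₂⟩ hz.2)
  have hp : ∀ z ∈ Ioc R x, p₂ z < p₁ z := fun z hz =>
    H₁.slope_lt_of_lt hn hR H₂ hz.1 (hs₁ z hz).2 (hs₂ z hz).2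
      (fun t ht => hlt t ⟨ht.1, ht.2.trans hz.2⟩)
  have hd : ∀ z ∈ Ioc R x, HasDerivAt (fun y => u₁ y - u₂ y) (p₁ z - p₂ z) z :=
    fun z hz => (H₁.hasDerivAt z (hs₁ z hz)).sub (H₂.hasDerivAt z (hs₂ z hz))
  have hlim : Tendsto (fun y => u₁ y - u₂ y) (𝓝[>] R) (𝓝 (h₁ - h₂)) := H₁.tendsto.sub H₂.tendsto
  have hid : Tendsto (fun y : ℝ => y) (𝓝[>] R) (𝓝 R) := tendsto_id.mono_left nhdsWithin_le_nhds
  have hθ : ∀ z ∈ Ioc R x,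
      Real.arctan (p₁ z) - Real.arctan (p₂ z) ≤ L * (z * (u₁ z - u₂ z)) := by
    intro z hz
    have hsub : ∀ t ∈ Ioc R z, t ∈ Ioc R x := fun t ht => ⟨ht.1, ht.2.trans hz.2⟩
    have hlim' : Tendsto
        (fun y => Real.arctan (p₁ y) - Real.arctan (p₂ y) - L * (y * (u₁ y - u₂ y))) (𝓝[>] R)
        (𝓝 (-(L * (R * (h₁ - h₂))))) := by
      simpa using (((Real.continuous_arctan.tendsto 0).comp H₁.tendsto_slope).sub
        ((Real.continuous_arctan.tendsto 0).comp H₂.tendsto_slope)).sub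
        ((hid.mul hlim).const_mul L)
    have h1 := le_of_hasDerivAt_nonpos_of_tendsto hz.1 (fun t ht =>
      ((H₁.hasDerivAt_arctan (hs₁ t (hsub t ht))).sub
        (H₂.hasDerivAt_arctan (hs₂ t (hsub t ht)))).sub
        (((hasDerivAt_id' t).mul (hd t (hsub t ht))).const_mul L)) hlim' (fun t ht => by
        have ht' := hsub t ht
        have ht0 : 0 < t := hR.trans_lt ht.1
        have h2 := radForce_sub_le n hδ (hδ₂ t ht') (hlt t ht').le
        have h3 : ((n : ℝ) - 1) / t * p₂ t ≤ ((n : ℝ) - 1) / t * p₁ t :=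
          mul_le_mul_of_nonneg_left (hp t ht').le (div_nonneg (by linarith) ht0.le)
        have h4 : 0 ≤ L * (t * (p₁ t - p₂ t)) :=
          mul_nonneg hL0 (mul_nonneg ht0.le (sub_nonneg.2 (hp t ht').le))
        rw [← hL] at h2
        linarith)
    simp only [Pi.sub_apply, Pi.mul_apply] at h1
    have h5 : 0 ≤ L * (R * (h₁ - h₂)) := mul_nonneg hL0 (mul_nonneg hR (sub_nonneg.2 hh.le))
    linarith
  have hgrow : ∀ z ∈ Ioc R x, p₁ z - p₂ z ≤ D * (u₁ z - u₂ z) := by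
    intro z hz
    have h1 := (H₂.neg_lt_slope hn hR (hs₂ z hz) hδ (hδ₂ z hz) (hz.2.trans hxB)).le
    have h2 := H₁.slope_neg hn hR (hs₁ z hz)
    have h3 : 0 ≤ M := by positivity
    have h4 := sub_le_mul_arctan_sub h1 (hp z hz).le (h2.le.trans h3)
    have h5 := hθ z hz
    have h6 : L * (z * (u₁ z - u₂ z)) ≤ L * (B * (u₁ z - u₂ z)) :=
      mul_le_mul_of_nonneg_left (mul_le_mul_of_nonneg_right (hz.2.trans hxB)
        (sub_nonneg.2 (hlt z hz).le)) hL0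
    calc p₁ z - p₂ z ≤ (1 + M ^ 2) * (Real.arctan (p₁ z) - Real.arctan (p₂ z)) := h4
      _ ≤ (1 + M ^ 2) * (L * (B * (u₁ z - u₂ z))) := by
        exact mul_le_mul_of_nonneg_left (h5.trans h6) (by positivity)
      _ = D * (u₁ z - u₂ z) := by rw [hD]; ring
  have hexp : ∀ z : ℝ, HasDerivAt (fun y => Real.exp (-D * y)) (Real.exp (-D * z) * -D) z :=
    fun z => by simpa using ((hasDerivAt_id' z).const_mul (-D)).exp
  have hfin := le_of_hasDerivAt_nonpos_of_tendsto hRx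
    (fun z hz => (hexp z).mul (hd z hz))
    (((hexp R).continuousAt.tendsto.mono_left nhdsWithin_le_nhds).mul hlim) (fun z hz => by
      have := mul_le_mul_of_nonneg_left (hgrow z hz) (Real.exp_pos (-D * z)).le
      linarith)
  have hR1 : Real.exp (-D * R) * (h₁ - h₂) ≤ 1 * (h₁ - h₂) := by
    refine mul_le_mul_of_nonneg_right (Real.exp_le_one_iff.2 ?_) (sub_nonneg.2 hh.le)
    nlinarith
  have hxe : Real.exp (D * x) * Real.exp (-D * x) = 1 := by
    rw [← Real.exp_add]
    simp
  calc u₁ x - u₂ x = Real.exp (D * x) * (Real.exp (-D * x) * (u₁ x - u₂ x)) := by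
        rw [← mul_assoc, hxe, one_mul]
    _ ≤ Real.exp (D * x) * (h₁ - h₂) := by
        refine mul_le_mul_of_nonneg_left ?_ (Real.exp_pos _).le
        simp only [Pi.mul_apply] at hfin
        linarith
    _ ≤ Real.exp (D * B) * (h₁ - h₂) := by
        have : 0 ≤ h₁ - h₂ := sub_nonneg.2 hh.le
        gcongr

end Comparison

/-- Solutions starting high enough survive past a prescribed radius. -/
lemma IsMaxSol.exists_radius_gt {n : ℕ} {R ρ : ℝ} (hn : 2 ≤ n) (hR : 0 ≤ R) (hρ : R < ρ) :
    ∃ H > 0, ∀ {h b : ℝ} {u : ℝ → ℝ}, H ≤ h → IsMaxSol n R h b u → ρ < b := by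
  have hρ0 : 0 < ρ := hR.trans_lt hρ
  refine ⟨2 * (ρ * (ρ * (n + 2))) + 2, by positivity, ?_⟩
  intro h b u hh hu
  by_contra! hb
  have hi := hu.isInitSol
  have hρn : 0 ≤ ρ * (ρ * (n + 2)) := by positivity
  have hδ : 1 ≤ h / 2 := by linarith
  obtain ⟨x, hx, hxlt⟩ := hu.exists_lt hn hR (by linarith : 0 < h / 2)
  obtain ⟨z, hz, hz0, hpos⟩ := exists_first_eq (c := h / 2)
    (fun y hy => (hi.hasDerivAt y hy).continuousAt.continuousWithinAt) hi.tendsto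
    (by linarith) hx hxlt.le
  have hsub : ∀ y ∈ Ioc R z, y ∈ Ioo R b := fun y hy => ⟨hy.1, (hy.2.trans hz.2).trans_lt hx.2⟩
  set M : ℝ := ρ * (n + 2) with hM
  have hslope : ∀ y ∈ Ioc R z, -M ≤ deriv u y := by
    intro y hy
    have hy1 : 1 ≤ u y := by
      rcases hy.2.eq_or_lt with h | h
      · rw [h, hz0]; exact hδ
      · exact hδ.trans (hpos y ⟨hy.1, h⟩).le
    have := hi.neg_lt_slope hn hR (hsub y hy) one_pos hy1 ((hsub y hy).2.le.trans hb)
    rw [hM]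
    norm_num at this
    linarith
  have h1 := le_of_hasDerivAt_nonpos_of_tendsto (f := fun y => -(u y + M * y)) hz.1
    (fun y hy => ((hi.hasDerivAt y (hsub y hy)).add ((hasDerivAt_id' y).const_mul M)).neg)
    ((hi.tendsto.add ((tendsto_id.mono_left nhdsWithin_le_nhds).const_mul M)).neg)
    (fun y hy => by linarith [hslope y hy])
  have hM0 : 0 ≤ M := by positivity
  have h2 : M * z ≤ M * ρ := mul_le_mul_of_nonneg_left ((hz.2.trans hx.2.le).trans hb) hM0
  have h3 : 0 ≤ M * R := mul_nonneg hM0 hR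
  linarith [h1, hM.le]

/-- A solution of sufficiently small height at radius `ρ` ends before radius `ρ + l`. -/
lemma IsInitSol.exists_radius_le {n : ℕ} {R ρ l : ℝ} (hn : 2 ≤ n) (hR : 0 ≤ R) (hρ : R < ρ)
    (hl : 0 < l) :
    ∃ ε > 0, ∀ {h b : ℝ} {u p : ℝ → ℝ}, IsInitSol n R h b u p → ρ < b → u ρ ≤ ε →
      b ≤ ρ + l := by
  have hn' : (2 : ℝ) ≤ n := by exact_mod_cast hn
  have hn1 : (0 : ℝ) ≤ n - 1 := by linarith
  have hρ0 : 0 < ρ := hR.trans_lt hρ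
  set A : ℝ := ((n : ℝ) - 1) / ρ * (2 / l) with hA
  have hA0 : 0 ≤ A := by positivity
  set c : ℝ := 2 * Real.pi / l + 1 with hc
  have hc0 : 0 < c := by positivity
  refine ⟨1 / (A + c + 1), by positivity, ?_⟩
  intro h b u p hu hρb huε
  by_contra! hb
  set ε : ℝ := 1 / (A + c + 1) with hε
  have hε0 : 0 < ε := by positivity
  have hε1 : ε ≤ 1 := by
    rw [hε, div_le_one (by positivity)]
    linarith
  have hεinv : A + c ≤ 1 / ε ^ 2 := by
    rw [hε, div_pow, one_div_div]
    nlinarith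
  have hsub : ∀ z ∈ Icc ρ (ρ + l), z ∈ Ioo R b := fun z hz =>
    ⟨hρ.trans_le hz.1, hz.2.trans_lt hb⟩
  have hule : ∀ z ∈ Icc ρ (ρ + l), u z ≤ ε := fun z hz =>
    ((hu.strictAntiOn hn hR).antitoneOn ⟨hρ, hρb⟩ (hsub z hz) hz.1).trans huε
  obtain ⟨x, hx, hpx⟩ := exists_hasDerivAt_eq_slope u p
    (by linarith : ρ + l / 2 < ρ + l)
    (fun z hz => (hu.hasDerivAt z (hsub z ⟨by linarith [hz.1], hz.2⟩)).continuousAt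
      |>.continuousWithinAt)
    (fun z hz => hu.hasDerivAt z (hsub z ⟨by linarith [hz.1], hz.2.le⟩))
  have hpx' : -(ε * (2 / l)) ≤ p x := by
    have h1 := hule (ρ + l / 2) ⟨by linarith, by linarith⟩
    have h2 := hu.pos (ρ + l) (hsub _ ⟨by linarith, le_rfl⟩)
    have h3 : ρ + l - (ρ + l / 2) = l / 2 := by ring
    rw [hpx, h3, show -(ε * (2 / l)) = -ε / (l / 2) by field_simp]
    gcongr
    linarith
  have hforce : ∀ z ∈ Icc ρ x, -(ε * (2 / l)) ≤ p z →
      -(((n : ℝ) - 1) / z * p z) - (1 + (n : ℝ) * u z) / u z ^ 2 ≤ -c := by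
    intro z hz hpz
    have hz' : z ∈ Icc ρ (ρ + l) := ⟨hz.1, hz.2.trans hx.2.le⟩
    have hup := hu.pos z (hsub z hz')
    have hz0 : 0 < z := hρ0.trans_le hz.1
    have h1 : 1 / ε ^ 2 ≤ (1 + (n : ℝ) * u z) / u z ^ 2 := by
      have := hule z hz'
      have h2 : 1 ≤ 1 + (n : ℝ) * u z := by
        have : 0 ≤ (n : ℝ) * u z := by positivity
        linarith
      gcongr
    have h3 : ((n : ℝ) - 1) / z * (-p z) ≤ A := by
      calc ((n : ℝ) - 1) / z * (-p z) ≤ ((n : ℝ) - 1) / z * (1 * (2 / l)) := by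
            refine mul_le_mul_of_nonneg_left ?_ (by positivity)
            have : ε * (2 / l) ≤ 1 * (2 / l) := by gcongr
            linarith
        _ ≤ A := by
            rw [hA, one_mul]
            have := hz.1
            gcongr
    linarith
  have hle : ∀ y ∈ Icc ρ x, -(ε * (2 / l)) ≤ p y := by
    intro y hy
    have h1 := le_right_of_hasDerivAt_pos (f := fun z => -p z) hy.2
      (fun z hz => (hu.hasDerivAt_slope z
        (hsub z ⟨hy.1.trans hz.1, hz.2.trans hx.2.le⟩)).neg)
      (fun z hz hpz => by
        have := hforce z ⟨hy.1.trans hz.1, hz.2⟩ (by linarith)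
        rw [radAcc, ← mul_neg]
        exact mul_pos (by positivity) (by linarith))
    linarith
  have hρx : ρ ≤ x := by linarith [hx.1]
  have hanti := antitoneOn_of_hasDerivAt_nonpos (f := fun y => Real.arctan (p y) + c * y)
    (convex_Icc ρ x)
    (fun z hz => (hu.hasDerivAt_arctan (hsub z ⟨hz.1, hz.2.trans hx.2.le⟩)).add
      ((hasDerivAt_id' z).const_mul c))
    (fun z hz => by linarith [hforce z hz (hle z hz)])
    (left_mem_Icc.2 hρx) (right_mem_Icc.2 hρx) hρx
  simp only at hanti
  have h1 := Real.neg_pi_div_two_lt_arctan (p x)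
  have h2 := Real.arctan_lt_pi_div_two (p ρ)
  have h3 : c * (l / 2) ≤ c * (x - ρ) :=
    mul_le_mul_of_nonneg_left (by linarith [hx.1]) hc0.le
  have h4 : c * (l / 2) = Real.pi + l / 2 := by
    rw [hc]
    field_simp
  linarith

section Family

variable {n : ℕ} {R : ℝ} {r₂ : ℝ → ℝ} {U : ℝ → ℝ → ℝ}

lemma exists_radius_gt_and_eq (hn : 2 ≤ n) (hR : 0 ≤ R)
    (hfam : ∀ h : ℝ, 0 < h → IsMaxSol n R h (r₂ h) (U h)) {ρ y : ℝ} (hρ : R < ρ) (hy : 0 < y) :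
    ∃ h : ℝ, 0 < h ∧ ρ < r₂ h ∧ U h ρ = y := by
  have hi : ∀ h : ℝ, 0 < h → IsInitSol n R h (r₂ h) (U h) (deriv (U h)) := fun h hh =>
    (hfam h hh).isInitSol
  have hmono : ∀ {h₁ h₂ : ℝ}, 0 < h₂ → h₂ < h₁ → r₂ h₂ < r₂ h₁ := fun h2 h21 =>
    (hfam _ (h2.trans h21)).radius_lt hn hR (hfam _ h2) h21
  set A : Set ℝ := {h | 0 < h ∧ ρ < r₂ h ∧ y < U h ρ} with hA
  have hlb : ∀ h ∈ A, y ≤ h := fun h hh =>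
    (hh.2.2.trans ((hi h hh.1).lt_height hn hR ⟨hρ, hh.2.1⟩)).le
  have hup : ∀ h ∈ A, ∀ h', h < h' → h' ∈ A := by
    intro h hh h' hlt
    have h1 := hmono hh.1 hlt
    have h2 := (hi h' (hh.1.trans hlt)).sub_lt_sub hn hR (hi h hh.1) hlt hρ (hh.2.1.trans h1)
      hh.2.1
    exact ⟨hh.1.trans hlt, hh.2.1.trans h1, by linarith [hh.2.2]⟩
  have hne : A.Nonempty := by
    obtain ⟨H, hH, hH'⟩ := IsMaxSol.exists_radius_gt hn hR hρ
    have h1 := hH' le_rfl (hfam H hH)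
    have hHy : H < H + y := by linarith
    have hHy0 : 0 < H + y := by linarith
    have h2 := (hi (H + y) hHy0).sub_lt_sub hn hR (hi H hH) hHy hρ (h1.trans (hmono hH hHy)) h1
    exact ⟨H + y, hHy0, h1.trans (hmono hH hHy), by linarith [(hi H hH).pos ρ ⟨hρ, h1⟩]⟩
  have hbdd : BddBelow A := ⟨y, hlb⟩
  set s := sInf A with hs
  have hs0 : 0 < s := hy.trans_le (le_csInf hne hlb)
  have hgt : ∀ h, s < h → h ∈ A := fun h hh => by
    obtain ⟨a, ha, hah⟩ := exists_lt_of_csInf_lt hne hh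
    exact hup a ha h hah
  have hlt : ∀ h, h < s → h ∉ A := fun h hh => notMem_of_lt_csInf hh hbdd
  -- heights just above `s` give values at most those allowed by continuous dependence
  have hright : ∀ x, R < x → x < r₂ s → x ≤ ρ → y ≤ U s x := by
    intro x hRx hxs hxρ
    by_contra! hlt'
    obtain ⟨K, hK, hK'⟩ := IsInitSol.sub_le_exp_mul (B := ρ) hn hR
      ((hi s hs0).pos x ⟨hRx, hxs⟩)
    set η := (y - U s x) / K with hη
    have hη0 : 0 < η := div_pos (sub_pos.2 hlt') hK
    have hsη : s < s + η := by linarith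
    have hmem := hgt (s + η) hsη
    have hxr : x < r₂ (s + η) := hxs.trans (hmono hs0 hsη)
    have h1 := hK' (hi _ hmem.1) (hi s hs0) hsη hRx hxr hxs hxρ le_rfl
    have h2 := ((hi _ hmem.1).strictAntiOn hn hR).antitoneOn ⟨hRx, hxr⟩ ⟨hρ, hmem.2.1⟩ hxρ
    have h3 : K * (s + η - s) = y - U s x := by
      rw [hη, add_sub_cancel_left, mul_div_cancel₀ _ hK.ne']
    linarith [hmem.2.2]
  have hρs : ρ < r₂ s := by
    by_contra! hle
    obtain ⟨x, hx, hxy⟩ := (hfam s hs0).exists_lt hn hR hy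
    exact absurd (hright x hx.1 hx.2 (hx.2.le.trans hle)) (not_le.2 hxy)
  refine ⟨s, hs0, hρs, le_antisymm ?_ (hright ρ hρ hρs le_rfl)⟩
  by_contra! hys
  set Y := U s ρ with hY
  obtain ⟨K, hK, hK'⟩ := IsInitSol.sub_le_exp_mul (n := n) (R := R) (B := ρ) hn hR hy
  -- a slightly smaller height still gives a value above `y`
  obtain ⟨η, hη0, hη1, hη2⟩ : ∃ η > 0, η < s - y ∧ K * η < Y - y := by
    have hYs : Y < s := (hi s hs0).lt_height hn hR ⟨hρ, hρs⟩
    refine ⟨min ((s - y) / 2) ((Y - y) / (2 * K)), lt_min (by linarith)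
      (div_pos (sub_pos.2 hys) (by linarith)), (min_le_left _ _).trans_lt (by linarith), ?_⟩
    calc K * min ((s - y) / 2) ((Y - y) / (2 * K)) ≤ K * ((Y - y) / (2 * K)) := by
          gcongr
          exact min_le_right _ _
      _ = (Y - y) / 2 := by field_simp
      _ < Y - y := by linarith
  have ht0 : 0 < s - η := by linarith
  have hts : s - η < s := by linarith
  have hrt := hmono ht0 hts
  have hKη : K * (s - (s - η)) = K * η := by ring
  have hge : ∀ x, R < x → x < r₂ (s - η) → x ≤ ρ → y < U (s - η) x := by
    intro x hRx hxr hxρ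
    by_contra! hle
    obtain ⟨z, hz, hzy, -⟩ := exists_first_eq (c := y)
      (fun t ht => ((hi _ ht0).hasDerivAt t ht).continuousAt.continuousWithinAt)
      (hi _ ht0).tendsto (by linarith) ⟨hRx, hxr⟩ hle
    have hzr : z < r₂ (s - η) := hz.2.trans_lt hxr
    have h1 := hK' (hi s hs0) (hi _ ht0) hts hz.1 (hzr.trans hrt) hzr (hz.2.trans hxρ) hzy.ge
    have h2 := ((hi s hs0).strictAntiOn hn hR).antitoneOn ⟨hz.1, hzr.trans hrt⟩
      ⟨hρ, hρs⟩ (hz.2.trans hxρ)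
    linarith
  have hρt : ρ < r₂ (s - η) := by
    by_contra! hle
    obtain ⟨x, hx, hxy⟩ := (hfam _ ht0).exists_lt hn hR hy
    exact absurd (hge x hx.1 hx.2 (hx.2.le.trans hle)) (not_lt.2 hxy.le)
  exact hlt _ hts ⟨ht0, hρt, hge ρ hρ hρt le_rfl⟩

lemma exists_radius_eq (hn : 2 ≤ n) (hR : 0 ≤ R)
    (hfam : ∀ h : ℝ, 0 < h → IsMaxSol n R h (r₂ h) (U h)) {B : ℝ} (hB : R < B) :
    ∃ h : ℝ, 0 < h ∧ r₂ h = B := by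
  have hi : ∀ h : ℝ, 0 < h → IsInitSol n R h (r₂ h) (U h) (deriv (U h)) := fun h hh =>
    (hfam h hh).isInitSol
  have hmono : ∀ {h₁ h₂ : ℝ}, 0 < h₂ → h₂ < h₁ → r₂ h₂ < r₂ h₁ := fun h2 h21 =>
    (hfam _ (h2.trans h21)).radius_lt hn hR (hfam _ h2) h21
  have hmono' : ∀ {h₁ h₂ : ℝ}, 0 < h₁ → r₂ h₂ < r₂ h₁ → h₂ < h₁ := fun h1 h21 => by
    by_contra! hle
    rcases hle.eq_or_lt with h | h
    · exact absurd h21 (by rw [h]; exact lt_irrefl _)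
    · exact absurd h21 (hmono h1 h).not_gt
  set T : Set ℝ := {h | 0 < h ∧ B < r₂ h} with hT
  have hne : T.Nonempty := by
    obtain ⟨h, hh, hBh, -⟩ := exists_radius_gt_and_eq hn hR hfam hB one_pos
    exact ⟨h, hh, hBh⟩
  -- a solution that is low enough at `ρ < B` does not reach past `B`
  have hdeath : ∀ ρ, R < ρ → ρ < B → ∃ ε > 0, ∀ h, 0 < h → ρ < r₂ h → U h ρ ≤ ε →
      r₂ h ≤ B := by
    intro ρ hρ hρB
    obtain ⟨ε, hε, hε'⟩ := IsInitSol.exists_radius_le hn hR hρ (sub_pos.2 hρB)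
    refine ⟨ε, hε, fun h hh hρh hle => ?_⟩
    have := hε' (hi h hh) hρh hle
    linarith
  obtain ⟨ε, hε, hεT⟩ : ∃ ε > 0, ∀ h ∈ T, ε ≤ h := by
    obtain ⟨ρ, hρ, hρB⟩ := exists_between hB
    obtain ⟨ε, hε, hε'⟩ := hdeath ρ hρ hρB
    refine ⟨ε, hε, fun h hh => ?_⟩
    by_contra! hlt
    have hρh := hρB.trans hh.2
    exact absurd (hε' h hh.1 hρh (((hi h hh.1).lt_height hn hR ⟨hρ, hρh⟩).trans hlt).le)
      (not_le.2 hh.2)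
  set s := sInf T with hs
  have hs0 : 0 < s := hε.trans_le (le_csInf hne hεT)
  have hgt : ∀ h, s < h → B < r₂ h := fun h hh => by
    obtain ⟨a, ha, hah⟩ := exists_lt_of_csInf_lt hne hh
    exact ha.2.trans (hmono ha.1 hah)
  refine ⟨s, hs0, le_antisymm ?_ ?_⟩
  · by_contra! hlt
    have hpos := (hi s hs0).pos B ⟨hB, hlt⟩
    obtain ⟨h, hh, hBh, hUh⟩ := exists_radius_gt_and_eq hn hR hfam hB (half_pos hpos)
    have hsh : s ≤ h := csInf_le ⟨ε, hεT⟩ ⟨hh, hBh⟩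
    rcases hsh.eq_or_lt with h1 | h1
    · rw [← h1] at hUh
      linarith
    · have := (hi h hh).sub_lt_sub hn hR (hi s hs0) h1 hB hBh hlt
      linarith
  · by_contra! hlt
    obtain ⟨ρ, hρ, hρB⟩ := exists_between hlt
    have hRρ : R < ρ := (hfam s hs0).1.trans hρ
    obtain ⟨ε', hε', hle⟩ := hdeath ρ hRρ hρB
    obtain ⟨h, hh, hρh, hUh⟩ := exists_radius_gt_and_eq hn hR hfam hRρ hε'
    exact absurd (hle h hh hρh hUh.le) (not_le.2 (hgt h (hmono' hh (hρ.trans hρh))))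

end Family

/-- Lemma 3.9, second part: for the family `u_h` of maximal radial
solutions with top height `h` and maximal radius `r₂(h)`: the family is strictly
increasing in `h`, `r₂` is a continuous strictly increasing bijection from `(0,∞)`
onto `(R,∞)` (in particular `r₂(h) → ∞` as `h → ∞`), and the graphs of the `u_h`
foliate the region `{(ρ,y) : ρ > R, y > 0}`. -/
theorem rot_soliton_foliation (n : ℕ) (hn : 2 ≤ n) (R : ℝ) (hR : 0 ≤ R)
    (r₂ : ℝ → ℝ) (U : ℝ → ℝ → ℝ)
    (hfam : ∀ h : ℝ, 0 < h → IsMaxSol n R h (r₂ h) (U h)) :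
    (∀ h₁ h₂ : ℝ, 0 < h₂ → h₂ < h₁ →
      r₂ h₂ < r₂ h₁ ∧
      ∀ ρ ∈ Set.Ioo R (min (r₂ h₁) (r₂ h₂)), U h₂ ρ < U h₁ ρ) ∧
    (ContinuousOn r₂ (Set.Ioi 0) ∧ StrictMonoOn r₂ (Set.Ioi 0) ∧
      Set.BijOn r₂ (Set.Ioi 0) (Set.Ioi R) ∧
      Filter.Tendsto r₂ Filter.atTop Filter.atTop) ∧
    (∀ ρ₀ y₀ : ℝ, R < ρ₀ → 0 < y₀ →
      ∃! h : ℝ, 0 < h ∧ ρ₀ < r₂ h ∧ U h ρ₀ = y₀) := by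
  have hi : ∀ h : ℝ, 0 < h → IsInitSol n R h (r₂ h) (U h) (deriv (U h)) := fun h hh =>
    (hfam h hh).isInitSol
  have hmono : StrictMonoOn r₂ (Ioi 0) := fun a ha b hb hab =>
    (hfam b hb).radius_lt hn hR (hfam a ha) hab
  have hmaps : MapsTo r₂ (Ioi 0) (Ioi R) := fun h hh => (hfam h hh).1
  have hsurj : SurjOn r₂ (Ioi 0) (Ioi R) := fun B hB => by
    obtain ⟨h, hh, hr⟩ := exists_radius_eq hn hR hfam hB
    exact ⟨h, hh, hr⟩
  refine ⟨fun h₁ h₂ h2 h21 => ⟨hmono h2 (h2.trans h21) h21, fun ρ hρ => ?_⟩,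
    ⟨fun h hh => ?_, hmono, ⟨hmaps, hmono.injOn, hsurj⟩, ?_⟩, fun ρ₀ y₀ hρ hy => ?_⟩
  · exact (hi h₁ (h2.trans h21)).lt_of_lt hn hR (hi h₂ h2) h21 ρ hρ
  · refine (hmono.continuousAt_of_image_mem_nhds (Ioi_mem_nhds hh) ?_).continuousWithinAt
    exact mem_of_superset (Ioi_mem_nhds (hmaps hh)) hsurj
  · rw [tendsto_atTop]
    intro B
    have hRB : R < max B (R + 1) := (lt_add_one R).trans_le (le_max_right _ _)
    obtain ⟨h, hh, hr⟩ := hsurj hRB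
    filter_upwards [eventually_gt_atTop h] with h' hh'
    have := hmono hh (mem_Ioi.2 ((mem_Ioi.1 hh).trans hh')) hh'
    rw [hr] at this
    exact (le_max_left _ _).trans this.le
  · obtain ⟨h, hh, hρh, hU⟩ := exists_radius_gt_and_eq hn hR hfam hρ hy
    refine ⟨h, ⟨hh, hρh, hU⟩, fun h' ⟨hh', hρh', hU'⟩ => ?_⟩
    rcases lt_trichotomy h' h with hlt | heq | hlt
    · have := (hi h hh).lt_of_lt hn hR (hi h' hh') hlt ρ₀ ⟨hρ, lt_min hρh hρh'⟩
      linarith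
    · exact heq
    · have := (hi h' hh').lt_of_lt hn hR (hi h hh) hlt ρ₀ ⟨hρ, lt_min hρh' hρh⟩
      linarith
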